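/- arXiv:2009.07588 — 5 statements merged into one kernel-verified Lean document; each statement's English description precedes it below -/
import Mathlib

section
/- Let A be a finite set of arcs, each arc a ∈ A equipped with a travel time function τ_a satisfying the FIFO property, and let b : ℝ → ℝ be a locally integrable function with b(μ) ≥ ρ for all μ, where ρ > 0. Suppose that for every arc a ∈ A there is a constant c_a ∈ ℝ such that ∫_t^{t+τ_a(t)} b(μ) dμ = c_a for all t ≥ 0 (i.e. the step-cost function b generates a constant travel cost on every arc). Then the collection (τ_a)_{a∈A} is path ranking invariant: for any two paths p and p′ and any two start times t ≥ 0 and t′ ≥ 0, the duration of p is less than or equal to the duration of p′ when both start at time t if and only if the duration of p is less than or equal to the duration of p′ when both start at time t′. -/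
open MeasureTheory

/-- Arrival time of a path `p = (a₁, …, a_k)` started at time `t`:
`A(p,0,t) = t`, `A(p,j,t) = A(p,j-1,t) + τ_{a_j}(A(p,j-1,t))`. -/
noncomputable def arrivalTime {A : Type*} (τ : A → ℝ → ℝ) (p : List A) (t : ℝ) : ℝ :=
  p.foldl (fun s a => s + τ a s) t

theorem intervalIntegral_le_iff_of_pos {b : ℝ → ℝ} (hb : LocallyIntegrable b volume)
    (hb_pos : ∀ μ : ℝ, 0 < b μ) (t : ℝ) {x y : ℝ} :
    (∫ μ in t..x, b μ) ≤ (∫ μ in t..y, b μ) ↔ x ≤ y := by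
  have hmono : StrictMono fun x => ∫ μ in t..x, b μ := by
    intro x y hxy
    have hint (u v : ℝ) : IntervalIntegrable b volume u v :=
      (hb.integrableOn_isCompact isCompact_uIcc).intervalIntegrable
    have hadd := intervalIntegral.integral_add_adjacent_intervals (hint t x) (hint x y)
    have hlt : 0 < ∫ μ in x..y, b μ :=
      intervalIntegral.intervalIntegral_pos_of_pos (hint x y) hb_pos hxy
    change (∫ μ in t..x, b μ) < ∫ μ in t..y, b μ
    linarith
  exact hmono.le_iff_le

theorem integral_arrivalTime_eq_sum {A : Type*} {τ : A → ℝ → ℝ}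
    (hpos : ∀ (a : A) (t : ℝ), 0 < τ a t) {b : ℝ → ℝ} (hb : LocallyIntegrable b volume)
    {c : A → ℝ} (hc : ∀ (a : A) (t : ℝ), 0 ≤ t → (∫ μ in t..(t + τ a t), b μ) = c a)
    (p : List A) {t : ℝ} (ht : 0 ≤ t) :
    (∫ μ in t..arrivalTime τ p t, b μ) = (p.map c).sum := by
  induction p generalizing t with
  | nil => simp [arrivalTime]
  | cons a p ih =>
    have hstep : arrivalTime τ (a :: p) t = arrivalTime τ p (t + τ a t) := rfl
    rw [hstep, List.map_cons, List.sum_cons, ← hc a t ht,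
      ← ih (add_nonneg ht (hpos a t).le)]
    exact (intervalIntegral.integral_add_adjacent_intervals
      (hb.integrableOn_isCompact isCompact_uIcc).intervalIntegrable
      (hb.integrableOn_isCompact isCompact_uIcc).intervalIntegrable).symm

/-- If a locally integrable unit-cost function `b ≥ ρ > 0` generates a constant
travel cost on every arc of a finite set of FIFO arcs, then the collection of
travel time functions is path ranking invariant: the ordering of any two paths
by duration is independent of the (nonnegative) start time. -/
theorem stmt0 {A : Type*} [Fintype A] (τ : A → ℝ → ℝ)
    (hpos : ∀ (a : A) (t : ℝ), 0 < τ a t)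
    (hFIFO : ∀ a : A, StrictMono (fun t => t + τ a t))
    (b : ℝ → ℝ) (hb : LocallyIntegrable b volume)
    (ρ : ℝ) (hρ : 0 < ρ) (hbρ : ∀ μ : ℝ, ρ ≤ b μ)
    (hconst : ∀ a : A, ∃ c : ℝ, ∀ t : ℝ, 0 ≤ t →
      (∫ μ in t..(t + τ a t), b μ) = c) :
    ∀ (p p' : List A) (t t' : ℝ), 0 ≤ t → 0 ≤ t' →
      (arrivalTime τ p t - t ≤ arrivalTime τ p' t - t ↔
        arrivalTime τ p t' - t' ≤ arrivalTime τ p' t' - t') := by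
  choose c hc using hconst
  have key (p p' : List A) (t : ℝ) (ht : 0 ≤ t) :
      arrivalTime τ p t - t ≤ arrivalTime τ p' t - t ↔ (p.map c).sum ≤ (p'.map c).sum := by
    rw [sub_le_sub_iff_right, ← integral_arrivalTime_eq_sum hpos hb hc p ht,
      ← integral_arrivalTime_eq_sum hpos hb hc p' ht,
      intervalIntegral_le_iff_of_pos hb fun μ => hρ.trans_le (hbρ μ)]
  intro p p' t t' ht ht'
  rw [key p p' t ht, key p p' t' ht']
end

section
/- Let A be a finite set of arcs, each arc a ∈ A equipped with a travel time function τ_a with τ_a(t) > 0 for all t, and let b : ℝ → ℝ be a locally integrable function with b(μ) ≥ ρ for all μ, where ρ > 0. Suppose that for every arc a ∈ A there is a constant c_a ∈ ℝ such that ∫_t^{t+τ_a(t)} b(μ) dμ = c_a for all t ≥ 0. Then for any two paths p = (a_1, …, a_k) and p′ = (a′_1, …, a′_m) and any start time t ≥ 0: Σ_{j=1}^{k} c_{a_j} ≤ Σ_{j=1}^{m} c_{a′_j} if and only if A(p, k, t) ≤ A(p′, m, t), i.e. the ordering of paths by total constant cost coincides with their ordering by arrival time (equivalently, by duration) for every start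 time. -/
open MeasureTheory

/-- Local integrability gives interval integrability on every interval of the line. -/
theorem MeasureTheory.LocallyIntegrable.intervalIntegrable_real {b : ℝ → ℝ}
    (hb : LocallyIntegrable b volume) (x y : ℝ) : IntervalIntegrable b volume x y :=
  (hb.integrableOn_isCompact isCompact_uIcc).intervalIntegrable

/-- The primitive of a locally integrable function bounded below by a positive constant is
strictly increasing. -/
theorem strictMono_integral_of_pos_le {b : ℝ → ℝ} (hb : LocallyIntegrable b volume)
    {ρ : ℝ} (hρ : 0 < ρ) (hbρ : ∀ μ : ℝ, ρ ≤ b μ) (t : ℝ) :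
    StrictMono fun x => ∫ μ in t..x, b μ := by
  intro x y hxy
  have hadd := intervalIntegral.integral_add_adjacent_intervals
    (hb.intervalIntegrable_real t x) (hb.intervalIntegrable_real x y)
  have hle : ∫ _ in x..y, ρ ≤ ∫ μ in x..y, b μ :=
    intervalIntegral.integral_mono_on hxy.le intervalIntegrable_const
      (hb.intervalIntegrable_real x y) fun μ _ => hbρ μ
  rw [intervalIntegral.integral_const, smul_eq_mul] at hle
  have := mul_pos (sub_pos.2 hxy) hρ
  change ∫ μ in t..x, b μ < ∫ μ in t..y, b μ
  linarith

/-- If every arc has constant cost, the integral of `b` over the duration of a path is the total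
cost of its arcs. -/
theorem integral_arrivalTime {A : Type*} {τ : A → ℝ → ℝ} (hτ : ∀ (a : A) (t : ℝ), 0 ≤ τ a t)
    {b : ℝ → ℝ} (hb : LocallyIntegrable b volume) {c : A → ℝ}
    (hconst : ∀ (a : A) (t : ℝ), 0 ≤ t → (∫ μ in t..(t + τ a t), b μ) = c a)
    (p : List A) {t : ℝ} (ht : 0 ≤ t) :
    ∫ μ in t..arrivalTime τ p t, b μ = (p.map c).sum := by
  induction p generalizing t with
  | nil => simp [arrivalTime]
  | cons a p ih =>
    have h := ih (add_nonneg ht (hτ a t))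
    rw [List.map_cons, List.sum_cons, ← hconst a t ht, ← h]
    exact (intervalIntegral.integral_add_adjacent_intervals
      (hb.intervalIntegrable_real _ _) (hb.intervalIntegrable_real _ _)).symm

/-- If `b ≥ ρ > 0` generates a constant travel cost `c a` on every arc, then for any
start time `t ≥ 0` the ordering of paths by total constant cost coincides with their
ordering by arrival time (equivalently, by duration). -/
theorem stmt2 {A : Type*} [Fintype A] (τ : A → ℝ → ℝ)
    (hpos : ∀ (a : A) (t : ℝ), 0 < τ a t)
    (b : ℝ → ℝ) (hb : LocallyIntegrable b volume)
    (ρ : ℝ) (hρ : 0 < ρ) (hbρ : ∀ μ : ℝ, ρ ≤ b μ)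
    (c : A → ℝ)
    (hconst : ∀ (a : A) (t : ℝ), 0 ≤ t →
      (∫ μ in t..(t + τ a t), b μ) = c a) :
    ∀ (p p' : List A) (t : ℝ), 0 ≤ t →
      ((p.map c).sum ≤ (p'.map c).sum ↔ arrivalTime τ p t ≤ arrivalTime τ p' t) := by
  intro p p' t ht
  have hτ : ∀ (a : A) (t : ℝ), 0 ≤ τ a t := fun a t => (hpos a t).le
  rw [← integral_arrivalTime hτ hb hconst p ht, ← integral_arrivalTime hτ hb hconst p' ht]
  exact (strictMono_integral_of_pos_le hb hρ hbρ t).le_iff_le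
end

section
/- Let A be a finite set of arcs, each arc a ∈ A equipped with a travel time function τ_a satisfying the FIFO property, and suppose the travel times are constant in the long run: there is T > 0 such that τ_a(t) = τ_a(T) for all t ≥ T and all a ∈ A. Suppose further that the collection (τ_a)_{a∈A} is path ranking invariant: for any two paths p, p′ and any two start times t, t′ ≥ 0, the duration of p is ≤ the duration of p′ at start time t if and only if the same holds at start time t′. Then the time-invariant costs d(a) = τ_a(T) are valid for ranking: for any two paths p = (a_1, …, a_k) and p′ = (a′_1, …, a′_m) and any start time t ≥ 0, Σ_{j=1}^{k} τ_{a_j}(T) ≤ Σ_{j=1}^{m} τ_{a′_j}(T) if and only if the duration of p at start time t is ≤ the duration of p′ at start time t. -/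
/-- If all travel times are constant from time `T` on, then the arrival time from a start time
`t ≥ T` is `t` plus the total long-run cost of the path. -/
theorem arrivalTime_eq_add_sum_of_le {A : Type*} {τ : A → ℝ → ℝ} {T : ℝ}
    (hnonneg : ∀ a : A, 0 ≤ τ a T)
    (hlong : ∀ (a : A) (t : ℝ), T ≤ t → τ a t = τ a T) (p : List A) {t : ℝ} (ht : T ≤ t) :
    arrivalTime τ p t = t + (p.map (fun a => τ a T)).sum := by
  induction p generalizing t with
  | nil => simp [arrivalTime]
  | cons a p ih =>
    have h : arrivalTime τ (a :: p) t = arrivalTime τ p (t + τ a t) := rfl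
    rw [h, hlong a t ht, ih (by linarith [hnonneg a]), List.map_cons, List.sum_cons, add_assoc]

/-- For a path ranking invariant collection of FIFO travel time functions that are
constant in the long run (after time `T`), the time-invariant costs `d(a) = τ_a(T)`
are valid for ranking: the ordering of paths by total cost coincides with their
ordering by duration at any start time `t ≥ 0`. -/
theorem stmt3 {A : Type*} [Fintype A] (τ : A → ℝ → ℝ)
    (hpos : ∀ (a : A) (t : ℝ), 0 < τ a t)
    (hFIFO : ∀ a : A, StrictMono (fun t => t + τ a t))
    (T : ℝ) (hT : 0 < T)
    (hlong : ∀ (a : A) (t : ℝ), T ≤ t → τ a t = τ a T)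
    (hinv : ∀ (p p' : List A) (t t' : ℝ), 0 ≤ t → 0 ≤ t' →
      (arrivalTime τ p t - t ≤ arrivalTime τ p' t - t ↔
        arrivalTime τ p t' - t' ≤ arrivalTime τ p' t' - t')) :
    ∀ (p p' : List A) (t : ℝ), 0 ≤ t →
      ((p.map (fun a => τ a T)).sum ≤ (p'.map (fun a => τ a T)).sum ↔
        arrivalTime τ p t - t ≤ arrivalTime τ p' t - t) := by
  intro p p' t ht
  have hsum := fun q : List A =>
    arrivalTime_eq_add_sum_of_le (fun a => (hpos a T).le) hlong q le_rfl
  rw [hinv p p' t T ht hT.le, hsum p, hsum p', add_sub_cancel_left, add_sub_cancel_left]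
end

section
/- Let b : ℝ → ℝ be locally integrable with b(μ) ≥ ρ for all μ, where ρ > 0, let c̲ > 0, and let τ̲ : ℝ → ℝ be a function with τ̲(t) > 0 satisfying ∫_t^{t+τ̲(t)} b(μ) dμ = c̲ for all t ∈ ℝ. Then the arrival-time function Γ̲(t) = t + τ̲(t) is strictly increasing; that is, the travel time function implicitly generated by a positive unit cost function and a constant travel cost satisfies the FIFO property. -/
open MeasureTheory

/-- A travel time function implicitly generated by a unit cost function `b ≥ ρ > 0`
and a constant travel cost `c̲ > 0` satisfies the FIFO property: its arrival-time
function `Γ̲(t) = t + τ̲(t)` is strictly increasing. -/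
theorem stmt10 (b : ℝ → ℝ) (hb : LocallyIntegrable b volume)
    (ρ : ℝ) (hρ : 0 < ρ) (hbρ : ∀ μ : ℝ, ρ ≤ b μ)
    (clow : ℝ) (hc : 0 < clow)
    (τlow : ℝ → ℝ) (hτpos : ∀ t : ℝ, 0 < τlow t)
    (hτ : ∀ t : ℝ, (∫ μ in t..(t + τlow t), b μ) = clow) :
    StrictMono (fun t => t + τlow t) := by
  have hint : ∀ x y : ℝ, IntervalIntegrable b volume x y := fun x y =>
    (hb.integrableOn_isCompact isCompact_uIcc).intervalIntegrable
  have hlower : ∀ x y : ℝ, x ≤ y → ρ * (y - x) ≤ ∫ μ in x..y, b μ := by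
    intro x y hxy
    have h := intervalIntegral.integral_mono_on hxy
      (intervalIntegrable_const (c := ρ)) (hint x y) fun μ _ => hbρ μ
    rw [intervalIntegral.integral_const, smul_eq_mul] at h
    linarith
  intro s t hst
  by_contra! hle
  have hle' : t + τlow t ≤ s + τlow s := hle
  have hsplit := intervalIntegral.integral_add_adjacent_intervals
    (hint s t) (hint t (t + τlow t))
  have hsplit' := intervalIntegral.integral_add_adjacent_intervals
    (hint s (t + τlow t)) (hint (t + τlow t) (s + τlow s))
  have h₁ := hlower s t hst.le
  have h₂ := hlower _ _ hle'
  have h₃ : 0 < ρ * (t - s) := mul_pos hρ (sub_pos.2 hst)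
  have h₄ : 0 ≤ ρ * (s + τlow s - (t + τlow t)) := mul_nonneg hρ.le (sub_nonneg.2 hle')
  linarith [hτ s, hτ t]
end

section
/- Let b : ℝ → ℝ be locally integrable with ρ ≤ b(μ) ≤ M for all μ, where 0 < ρ ≤ M, and let c̲ > 0. Then for every t ∈ ℝ there exists a unique s > 0 such that ∫_t^{t+s} b(μ) dμ = c̲, and this unique s satisfies c̲/M ≤ s ≤ c̲/ρ. (This establishes that the IGP-model travel time τ̲(t, b) characterized by ∫_t^{t+τ̲(t,b)} b(μ) dμ = c̲ is well defined.) -/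
open MeasureTheory

/-- For a locally integrable unit cost function `b` with `0 < ρ ≤ b ≤ M` and a
constant travel cost `c̲ > 0`, the IGP travel time is well defined: for every `t`
there is a unique `s > 0` with `∫_t^{t+s} b = c̲`, and it satisfies
`c̲/M ≤ s ≤ c̲/ρ`. -/
theorem stmt11 (b : ℝ → ℝ) (hb : LocallyIntegrable b volume)
    (ρ M : ℝ) (hρ : 0 < ρ) (hρM : ρ ≤ M)
    (hbl : ∀ μ : ℝ, ρ ≤ b μ) (hbu : ∀ μ : ℝ, b μ ≤ M)
    (clow : ℝ) (hc : 0 < clow) :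
    ∀ t : ℝ, (∃! s : ℝ, 0 < s ∧ (∫ μ in t..(t + s), b μ) = clow) ∧
      (∀ s : ℝ, 0 < s → (∫ μ in t..(t + s), b μ) = clow →
        clow / M ≤ s ∧ s ≤ clow / ρ) := by
  intro t
  have hM : 0 < M := hρ.trans_le hρM
  have hi : ∀ x y : ℝ, IntervalIntegrable b volume x y := fun x y =>
    (hb.integrableOn_isCompact isCompact_uIcc).intervalIntegrable
  have lower : ∀ x y : ℝ, x ≤ y → ρ * (y - x) ≤ ∫ μ in x..y, b μ := by
    intro x y hxy
    have h := intervalIntegral.integral_mono_on hxy intervalIntegrable_const (hi x y)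
      (fun μ _ => hbl μ)
    rw [intervalIntegral.integral_const, smul_eq_mul] at h
    linarith
  have upper : ∀ x y : ℝ, x ≤ y → ∫ μ in x..y, b μ ≤ M * (y - x) := by
    intro x y hxy
    have h := intervalIntegral.integral_mono_on hxy (hi x y) intervalIntegrable_const
      (fun μ _ => hbu μ)
    rw [intervalIntegral.integral_const, smul_eq_mul] at h
    linarith
  have mono : StrictMono fun s : ℝ => ∫ μ in t..(t + s), b μ := by
    intro r s hrs
    have hadd := intervalIntegral.integral_add_adjacent_intervals (hi t (t + r))
      (hi (t + r) (t + s))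
    have hlow := lower (t + r) (t + s) (by linarith)
    have hpos : 0 < ρ * (t + s - (t + r)) := mul_pos hρ (by linarith)
    change ∫ μ in t..(t + r), b μ < ∫ μ in t..(t + s), b μ
    linarith
  have cont : Continuous fun s : ℝ => ∫ μ in t..(t + s), b μ :=
    (intervalIntegral.continuous_primitive hi t).comp (continuous_const.add continuous_id)
  refine ⟨?_, fun s hs hsc => ?_⟩
  · have hcρ : 0 < clow / ρ := div_pos hc hρ
    have hend : clow ≤ ∫ μ in t..(t + clow / ρ), b μ := by
      have h := lower t (t + clow / ρ) (by linarith)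
      rwa [add_sub_cancel_left, mul_div_cancel₀ _ hρ.ne'] at h
    obtain ⟨s, hs, hsc⟩ := intermediate_value_Icc hcρ.le cont.continuousOn
      (show clow ∈ Set.Icc (∫ μ in t..(t + 0), b μ) (∫ μ in t..(t + clow / ρ), b μ) from
        ⟨by simpa using hc.le, hend⟩)
    refine ⟨s, ⟨hs.1.lt_of_ne ?_, hsc⟩, fun r hr => mono.injective (hr.2.trans hsc.symm)⟩
    rintro rfl
    simp only [add_zero, intervalIntegral.integral_same] at hsc
    exact hc.ne hsc
  · have hlow := lower t (t + s) (by linarith)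
    have hup := upper t (t + s) (by linarith)
    rw [add_sub_cancel_left, hsc] at hlow hup
    exact ⟨(div_le_iff₀' hM).2 hup, (le_div_iff₀' hρ).2 hlow⟩
end
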